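/- Let D be a PvMD with finite t-character and let I be a nonzero proper t-ideal of D. Then I is t-idempotent if and only if I = (P₁⋯Pₙ)^t for some finitely many t-idempotent prime t-ideals P₁, …, Pₙ of D. -/

import Mathlib

/-! Statement 17: Let D be a PvMD with finite t-character and I a nonzero proper t-ideal. Then I is t-idempotent iff I = (P1⋯Pn)^t for finitely many t-idempotent prime t-ideals Pi. -/

noncomputable section

/-- The image of an ideal of `D` in the fraction field of `D`, as a `D`-submodule. -/
def coeI (D : Type*) [CommRing D] [IsDomain D] (I : Ideal D) :
    Submodule D (FractionRing D) :=
  Submodule.map (Algebra.linearMap D (FractionRing D)) I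

/-- The `v`-operation on `D`-submodules of the fraction field `K`:
`E^v = (E⁻¹)⁻¹`, where `E⁻¹ = (D : E) = {x ∈ K : xE ⊆ D}`. -/
def vSub (D : Type*) [CommRing D] [IsDomain D] (E : Submodule D (FractionRing D)) :
    Submodule D (FractionRing D) :=
  1 / (1 / E)

/-- The `t`-operation: `E^t = ⋃ {F^v : F` a nonzero finitely generated submodule `⊆ E}`,
as a subset of the fraction field. -/
def tSet (D : Type*) [CommRing D] [IsDomain D] (E : Submodule D (FractionRing D)) :
    Set (FractionRing D) :=
  ⋃ F ∈ {F : Submodule D (FractionRing D) | F.FG ∧ F ≠ ⊥ ∧ F ≤ E},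
    (vSub D F : Set (FractionRing D))

/-- An integral ideal `I` of `D` is a `t`-ideal if `I^t = I`. -/
def IsTIdeal (D : Type*) [CommRing D] [IsDomain D] (I : Ideal D) : Prop :=
  tSet D (coeI D I) = (coeI D I : Set (FractionRing D))

/-- A nonzero ideal `I` of `D` is `t`-idempotent if `(I²)^t = I^t`. -/
def TIdem (D : Type*) [CommRing D] [IsDomain D] (I : Ideal D) : Prop :=
  tSet D (coeI D (I * I)) = tSet D (coeI D I)

/-- `D` is a Prüfer `v`-multiplication domain: `(F·F⁻¹)^t = D` for every nonzero
finitely generated ideal `F` of `D`. -/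
def IsPvMD (D : Type*) [CommRing D] [IsDomain D] : Prop :=
  ∀ F : Ideal D, F ≠ ⊥ → F.FG →
    tSet D (coeI D F * (1 / coeI D F)) =
      ((1 : Submodule D (FractionRing D)) : Set (FractionRing D))

/-- A `t`-maximal ideal: an ideal maximal among proper integral `t`-ideals. -/
def IsTMax (D : Type*) [CommRing D] [IsDomain D] (M : Ideal D) : Prop :=
  M ≠ ⊤ ∧ IsTIdeal D M ∧ ∀ J : Ideal D, J ≠ ⊤ → IsTIdeal D J → M ≤ J → J = M

/-- The localization `D_P` of `D` at a prime `P`, viewed as a subset of the fraction field: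
the set of fractions `a / s` with `s ∉ P`. -/
def locSet (D : Type*) [CommRing D] [IsDomain D] (P : Ideal D) : Set (FractionRing D) :=
  {x | ∃ a s : D, s ∉ P ∧ x * algebraMap D (FractionRing D) s = algebraMap D (FractionRing D) a}

/-- A prime `t`-ideal `P` is `t`-sharp if `⋂ {D_M : M t-maximal, M ⊉ P} ⊄ D_P`. -/
def IsTSharp (D : Type*) [CommRing D] [IsDomain D] (P : Ideal D) : Prop :=
  ¬ (⋂ M ∈ {M : Ideal D | IsTMax D M ∧ ¬ P ≤ M}, locSet D M) ⊆ locSet D P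

/-- A prime ideal `P` of `D` is branched if there is a `P`-primary ideal distinct from `P`. -/
def IsBranched (D : Type*) [CommRing D] [IsDomain D] (P : Ideal D) : Prop :=
  ∃ Q : Ideal D, Q.IsPrimary ∧ Q.radical = P ∧ Q ≠ P

/-- `D` has finite `t`-character: every nonzero element lies in only finitely many
`t`-maximal ideals. -/
def FiniteTCharacter (D : Type*) [CommRing D] [IsDomain D] : Prop :=
  ∀ a : D, a ≠ 0 → {M : Ideal D | IsTMax D M ∧ a ∈ M}.Finite

/-- A nonzero ideal `I` of `D` is divisorial if `(I⁻¹)⁻¹ = I`. -/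
def IsDivisorial (D : Type*) [CommRing D] [IsDomain D] (I : Ideal D) : Prop :=
  vSub D (coeI D I) = coeI D I


section TClosure

variable {D : Type*} [CommRing D]

/-- `x` belongs to `F^v`. -/
def MemV (F : Ideal D) (x : D) : Prop :=
  ∀ y : FractionRing D,
    (∀ f ∈ F, y * algebraMap D (FractionRing D) f ∈ (1 : Submodule D (FractionRing D))) →
      y * algebraMap D (FractionRing D) x ∈ (1 : Submodule D (FractionRing D))

/-- `x` belongs to `A^t`. -/
def MemT (A : Ideal D) (x : D) : Prop :=
  ∃ F : Ideal D, F.FG ∧ F ≠ ⊥ ∧ F ≤ A ∧ MemV F x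

theorem MemV.mono {F G : Ideal D} (h : F ≤ G) {x : D} (hx : MemV F x) : MemV G x :=
  fun y hy => hx y fun f hf => hy f (h hf)

theorem MemT.mono {A B : Ideal D} (h : A ≤ B) {x : D} (hx : MemT A x) : MemT B x := by
  obtain ⟨F, hF, hF0, hFA, hFx⟩ := hx
  exact ⟨F, hF, hF0, hFA.trans h, hFx⟩

theorem memT_of_mem_of_ne_zero {A : Ideal D} {x : D} (hx : x ∈ A) (h0 : x ≠ 0) : MemT A x :=
  ⟨Ideal.span {x}, Submodule.fg_span_singleton x, by simpa using h0, by simpa [Ideal.span_le] using hx,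
    fun _ hy => hy x (Ideal.mem_span_singleton_self x)⟩

theorem memT_of_mem {A : Ideal D} (hA : A ≠ ⊥) {x : D} (hx : x ∈ A) : MemT A x := by
  obtain ⟨a, ha, ha0⟩ := Submodule.exists_mem_ne_zero_of_ne_bot hA
  refine ⟨Ideal.span {a, x}, Submodule.fg_span (Set.toFinite _), fun h => ha0 ?_, ?_,
    fun _ hy => hy x (Ideal.subset_span (by simp))⟩
  · simpa [h] using (Ideal.subset_span (by simp) : a ∈ Ideal.span {a, x})
  · rw [Ideal.span_le]
    rintro _ (rfl | rfl)
    exacts [ha, hx]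

/-- The `t`-closure of a nonzero integral ideal. -/
def tClosure (A : Ideal D) (hA : A ≠ ⊥) : Ideal D where
  carrier := {x | MemT A x}
  zero_mem' := memT_of_mem hA (zero_mem A)
  add_mem' := by
    rintro x x' ⟨F, hF, hF0, hFA, hFx⟩ ⟨F', hF', -, hFA', hFx'⟩
    refine ⟨F ⊔ F', Submodule.FG.sup hF hF', fun h => hF0 (le_bot_iff.1 (h ▸ le_sup_left)),
      sup_le hFA hFA',
      fun y hy => ?_⟩
    rw [map_add, mul_add]
    exact add_mem (hFx.mono le_sup_left y hy) (hFx'.mono le_sup_right y hy)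
  smul_mem' := by
    rintro c x ⟨F, hF, hF0, hFA, hFx⟩
    refine ⟨F, hF, hF0, hFA, fun y hy => ?_⟩
    rw [smul_eq_mul, map_mul, mul_left_comm, ← Algebra.smul_def]
    exact Submodule.smul_mem _ _ (hFx y hy)

theorem le_tClosure (A : Ideal D) (hA : A ≠ ⊥) : A ≤ tClosure A hA := fun _ => memT_of_mem hA

theorem exists_fg_forall_memV {A : Ideal D} (hA : A ≠ ⊥) {F : Ideal D} (hF : F.FG)
    (h : F ≤ tClosure A hA) :
    ∃ G : Ideal D, G.FG ∧ G ≠ ⊥ ∧ G ≤ A ∧ ∀ f ∈ F, MemV G f := by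
  induction F, hF using Submodule.fg_induction with
  | singleton x =>
    obtain ⟨G, hG, hG0, hGA, hx⟩ := h (Submodule.mem_span_singleton_self x)
    refine ⟨G, hG, hG0, hGA, fun f hf y hy => ?_⟩
    obtain ⟨c, rfl⟩ := Submodule.mem_span_singleton.1 hf
    rw [smul_eq_mul, map_mul, mul_left_comm, ← Algebra.smul_def]
    exact Submodule.smul_mem _ _ (hx y hy)
  | sup F₁ F₂ _ _ ih₁ ih₂ =>
    obtain ⟨G₁, h₁, h₁0, h₁A, h₁F⟩ := ih₁ (le_sup_left.trans h)
    obtain ⟨G₂, h₂, -, h₂A, h₂F⟩ := ih₂ (le_sup_right.trans h)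
    refine ⟨G₁ ⊔ G₂, Submodule.FG.sup h₁ h₂, fun h => h₁0 (le_bot_iff.1 (h ▸ le_sup_left)),
      sup_le h₁A h₂A,
      fun f hf y hy => ?_⟩
    obtain ⟨f₁, hf₁, f₂, hf₂, rfl⟩ := Submodule.mem_sup.1 hf
    rw [map_add, mul_add]
    exact add_mem ((h₁F f₁ hf₁).mono le_sup_left y hy) ((h₂F f₂ hf₂).mono le_sup_right y hy)

theorem MemT.of_tClosure {A : Ideal D} (hA : A ≠ ⊥) {x : D} (hx : MemT (tClosure A hA) x) :
    MemT A x := by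
  obtain ⟨F, hF, -, hFA, hFx⟩ := hx
  obtain ⟨G, hG, hG0, hGA, hGF⟩ := exists_fg_forall_memV hA hF hFA
  exact ⟨G, hG, hG0, hGA, fun y hy => hFx y fun f hf => hGF f hf y hy⟩

/-- `x` lies in `A D_M`. -/
def MemLoc (M A : Ideal D) (x : D) : Prop := ∃ s ∉ M, s * x ∈ A

theorem memLoc_of_mem {M A : Ideal D} (hM : M ≠ ⊤) {x : D} (hx : x ∈ A) : MemLoc M A x :=
  ⟨1, fun h => hM ((Ideal.eq_top_iff_one M).2 h), by rwa [one_mul]⟩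

theorem MemLoc.trans {M A B : Ideal D} {x : D} (hx : MemLoc M A x) (hM : M.IsPrime)
    (hAB : ∀ a ∈ A, MemLoc M B a) : MemLoc M B x := by
  obtain ⟨s, hs, hsx⟩ := hx
  obtain ⟨u, hu, hux⟩ := hAB _ hsx
  exact ⟨u * s, fun h => (hM.mem_or_mem h).elim hu hs, by rwa [mul_assoc]⟩

theorem MemLoc.add {M A : Ideal D} (hM : M.IsPrime) {x y : D} (hx : MemLoc M A x)
    (hy : MemLoc M A y) : MemLoc M A (x + y) := by
  obtain ⟨s, hs, hsx⟩ := hx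
  obtain ⟨u, hu, huy⟩ := hy
  refine ⟨s * u, fun h => (hM.mem_or_mem h).elim hs hu, ?_⟩
  rw [mul_add]
  refine add_mem ?_ ?_
  · rw [mul_comm s, mul_assoc]
    exact A.mul_mem_left _ hsx
  · rw [mul_assoc]
    exact A.mul_mem_left _ huy

theorem MemLoc.mul_left {M A : Ideal D} {x : D} (c : D) (hx : MemLoc M A x) :
    MemLoc M A (c * x) := by
  obtain ⟨s, hs, hsx⟩ := hx
  exact ⟨s, hs, by rw [mul_left_comm]; exact A.mul_mem_left _ hsx⟩

theorem memLoc_mul {M A A' B B' : Ideal D} (hM : M.IsPrime) (h : ∀ a ∈ A, MemLoc M B a)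
    (h' : ∀ a ∈ A', MemLoc M B' a) : ∀ a ∈ A * A', MemLoc M (B * B') a := by
  intro a ha
  induction ha using Submodule.mul_induction_on' with
  | mem_mul_mem m hm n hn =>
    obtain ⟨s, hs, hsm⟩ := h m hm
    obtain ⟨u, hu, hun⟩ := h' n hn
    exact ⟨s * u, fun h => (hM.mem_or_mem h).elim hs hu, by
      rw [mul_mul_mul_comm]; exact Ideal.mul_mem_mul hsm hun⟩
  | add x _ y _ hx hy => exact hx.add hM hy

/-- The contraction of `A D_M` to `D`. -/
def locContraction (M : Ideal D) (hM : M.IsPrime) (A : Ideal D) : Ideal D where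
  carrier := {x | MemLoc M A x}
  zero_mem' := memLoc_of_mem hM.ne_top (zero_mem A)
  add_mem' := MemLoc.add hM
  smul_mem' c _ hx := hx.mul_left c

theorem mem_locContraction {M A : Ideal D} {hM : M.IsPrime} {x : D} :
    x ∈ locContraction M hM A ↔ MemLoc M A x := Iff.rfl

theorem le_locContraction (M : Ideal D) (hM : M.IsPrime) (A : Ideal D) :
    A ≤ locContraction M hM A := fun _ => memLoc_of_mem hM.ne_top

theorem locContraction_le_of_le {M I P : Ideal D} (hM : M.IsPrime) (hP : P.IsPrime) (hIP : I ≤ P)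
    (hPM : P ≤ M) : locContraction M hM I ≤ P := by
  rintro x ⟨s, hs, hsx⟩
  exact (hP.mem_or_mem (hIP hsx)).resolve_left fun h => hs (hPM h)

variable [IsDomain D]

theorem mem_coeI {A : Ideal D} {z : FractionRing D} :
    z ∈ coeI D A ↔ ∃ x ∈ A, algebraMap D (FractionRing D) x = z := Iff.rfl

theorem algebraMap_mem_coeI {A : Ideal D} {x : D} :
    algebraMap D (FractionRing D) x ∈ coeI D A ↔ x ∈ A := by
  rw [mem_coeI]
  refine ⟨?_, fun h => ⟨x, h, rfl⟩⟩
  rintro ⟨y, hy, h⟩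
  rwa [← IsFractionRing.injective D (FractionRing D) h]

theorem coeI_le_one (A : Ideal D) : coeI D A ≤ 1 := by
  rintro _ ⟨x, -, rfl⟩
  exact Submodule.mem_one.2 ⟨x, rfl⟩

theorem exists_coeI_eq {E : Submodule D (FractionRing D)} (hE : E ≤ 1) :
    ∃ A : Ideal D, coeI D A = E := by
  refine ⟨E.comap (Algebra.linearMap D (FractionRing D)), Submodule.map_comap_eq_of_le ?_⟩
  rwa [← Submodule.one_eq_range]

theorem algebraMap_mem_vSub_coeI {F : Ideal D} {x : D} :
    algebraMap D (FractionRing D) x ∈ vSub D (coeI D F) ↔ MemV F x := by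
  refine forall_congr' fun y => ?_
  refine imp_congr ⟨fun h f hf => h _ (algebraMap_mem_coeI.2 hf), ?_⟩ (by
    change algebraMap D (FractionRing D) x * y ∈ _ ↔ _
    rw [mul_comm])
  rintro h _ ⟨f, hf, rfl⟩
  exact h f hf

theorem vSub_le_one {E : Submodule D (FractionRing D)} (hE : E ≤ 1) : vSub D E ≤ 1 := by
  intro z hz
  simpa using hz 1 (fun e he => by simpa using hE he)

theorem mem_tSet_coeI {A : Ideal D} {z : FractionRing D} :
    z ∈ tSet D (coeI D A) ↔ ∃ x, MemT A x ∧ algebraMap D (FractionRing D) x = z := by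
  have hinj : Function.Injective (Algebra.linearMap D (FractionRing D)) :=
    IsFractionRing.injective D (FractionRing D)
  simp only [tSet, Set.mem_iUnion, Set.mem_ofPred_eq, SetLike.mem_coe, exists_prop]
  constructor
  · rintro ⟨E, ⟨hfg, h0, hE⟩, hz⟩
    obtain ⟨F, rfl⟩ := exists_coeI_eq (hE.trans (coeI_le_one A))
    obtain ⟨x, rfl⟩ := Submodule.mem_one.1 (vSub_le_one (coeI_le_one F) hz)
    refine ⟨x, ⟨F, Submodule.fg_of_fg_map_injective _ hinj hfg, ?_, ?_,
      algebraMap_mem_vSub_coeI.1 hz⟩, rfl⟩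
    · rintro rfl
      exact h0 (Submodule.map_bot _)
    · exact fun f hf => algebraMap_mem_coeI.1 (hE (algebraMap_mem_coeI.2 hf))
  · rintro ⟨x, ⟨F, hfg, h0, hFA, hx⟩, rfl⟩
    refine ⟨coeI D F, ⟨Submodule.FG.map _ hfg, ?_, Submodule.map_mono hFA⟩,
      algebraMap_mem_vSub_coeI.2 hx⟩
    exact fun h => h0 (Submodule.map_injective_of_injective hinj
      (h.trans (Submodule.map_bot _).symm))

theorem algebraMap_mem_tSet_coeI {A : Ideal D} {x : D} :
    algebraMap D (FractionRing D) x ∈ tSet D (coeI D A) ↔ MemT A x := by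
  rw [mem_tSet_coeI]
  refine ⟨?_, fun h => ⟨x, h, rfl⟩⟩
  rintro ⟨y, hy, h⟩
  rwa [← IsFractionRing.injective D (FractionRing D) h]

theorem tSet_coeI_subset_iff {A B : Ideal D} :
    tSet D (coeI D A) ⊆ tSet D (coeI D B) ↔ ∀ x, MemT A x → MemT B x := by
  constructor
  · exact fun h x hx => algebraMap_mem_tSet_coeI.1 (h (algebraMap_mem_tSet_coeI.2 hx))
  · intro h z hz
    obtain ⟨x, hx, rfl⟩ := mem_tSet_coeI.1 hz
    exact algebraMap_mem_tSet_coeI.2 (h x hx)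

theorem tSet_coeI_eq_coeI_iff {A B : Ideal D} :
    tSet D (coeI D A) = (coeI D B : Set (FractionRing D)) ↔ ∀ x, MemT A x ↔ x ∈ B := by
  constructor
  · intro h x
    rw [← algebraMap_mem_tSet_coeI, h, SetLike.mem_coe, algebraMap_mem_coeI]
  · intro h
    ext z
    rw [mem_tSet_coeI, SetLike.mem_coe, mem_coeI]
    simp only [h]

theorem isTIdeal_iff {A : Ideal D} : IsTIdeal D A ↔ ∀ x, MemT A x ↔ x ∈ A :=
  tSet_coeI_eq_coeI_iff

theorem IsTIdeal.ne_bot {A : Ideal D} (hA : IsTIdeal D A) : A ≠ ⊥ := by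
  rintro rfl
  obtain ⟨F, -, h0, hF, -⟩ := (isTIdeal_iff.1 hA 0).2 (zero_mem _)
  exact h0 (le_bot_iff.1 hF)

theorem tIdem_iff {A : Ideal D} : TIdem D A ↔ ∀ x, MemT A x → MemT (A * A) x := by
  rw [TIdem, subset_antisymm_iff, tSet_coeI_subset_iff, tSet_coeI_subset_iff]
  exact and_iff_right fun x hx => hx.mono Ideal.mul_le_right

/-- If `1 ∈ J^t` and `J` multiplies `x` into `A`, then `x ∈ A^t`. -/
theorem MemT.of_forall_mul_mem {J A : Ideal D} {x : D} (hA : A ≠ ⊥) (hJ : MemT J 1)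
    (h : ∀ s ∈ J, s * x ∈ A) : MemT A x := by
  obtain rfl | hx := eq_or_ne x 0
  · exact memT_of_mem hA (zero_mem A)
  obtain ⟨F, hF, hF0, hFJ, hF1⟩ := hJ
  refine ⟨Submodule.map (LinearMap.mulRight D x) F, Submodule.FG.map _ hF, ?_, ?_, fun y hy => ?_⟩
  · exact fun h => hF0 (Submodule.map_injective_of_injective (f := LinearMap.mulRight D x)
      (mul_left_injective₀ hx) (h.trans (Submodule.map_bot _).symm))
  · rintro _ ⟨f, hf, rfl⟩
    exact h f (hFJ hf)
  · have := hF1 (y * algebraMap D _ x) fun f hf => by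
      have := hy _ (Submodule.mem_map_of_mem hf)
      rwa [LinearMap.mulRight_apply, map_mul, mul_comm (algebraMap D _ f), ← mul_assoc] at this
    rwa [map_one, mul_one] at this

theorem IsTMax.one_not_memT {M : Ideal D} (hM : IsTMax D M) : ¬ MemT M 1 := fun h =>
  hM.1 ((Ideal.eq_top_iff_one M).2 ((isTIdeal_iff.1 hM.2.1 1).1 h))

theorem exists_isTMax_ge {J : Ideal D} (hJ0 : J ≠ ⊥) (hJ : ¬ MemT J 1) :
    ∃ M, IsTMax D M ∧ J ≤ M := by
  obtain ⟨M, hJM, hM⟩ := zorn_le_nonempty₀ {A : Ideal D | ¬ MemT A 1} (by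
    intro c hc hchain B hB
    refine ⟨sSup c, ?_, fun z hz => le_sSup hz⟩
    rintro ⟨F, hF, hF0, hFc, hF1⟩
    obtain ⟨A, hA, hFA⟩ := (CompleteLattice.isCompactElement_iff_le_of_directed_sSup_le _ F).1
      ((Submodule.fg_iff_compact F).1 hF) c ⟨B, hB⟩ hchain.directedOn hFc
    exact hc hA ⟨F, hF, hF0, hFA, hF1⟩) J hJ
  have hM0 : M ≠ ⊥ := fun h => hJ0 (le_bot_iff.1 (h ▸ hJM))
  refine ⟨M, ⟨?_, isTIdeal_iff.2 fun x => ⟨fun hx => ?_, memT_of_mem hM0⟩, fun A hA hAt hMA => ?_⟩,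
    hJM⟩
  · rintro rfl
    exact hM.1 (memT_of_mem hM0 Submodule.mem_top)
  · exact hM.2 (y := tClosure M hM0) (fun h => hM.1 (h.of_tClosure hM0)) (le_tClosure M hM0) hx
  · refine le_antisymm (hM.2 (fun h => hA ?_) hMA) hMA
    exact (Ideal.eq_top_iff_one A).2 ((isTIdeal_iff.1 hAt 1).1 h)

theorem IsTMax.isPrime {M : Ideal D} (hM : IsTMax D M) : M.IsPrime := by
  refine ⟨hM.1, fun {a b} hab => or_iff_not_imp_left.2 fun ha => ?_⟩
  have hM0 := hM.2.1.ne_bot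
  have hJ0 : M ⊔ Ideal.span {a} ≠ ⊥ := fun h => hM0 (le_bot_iff.1 (h ▸ le_sup_left))
  have hJ : MemT (M ⊔ Ideal.span {a}) 1 := by
    by_contra hJ
    obtain ⟨N, hN, hJN⟩ := exists_isTMax_ge hJ0 hJ
    have hNM := hM.2.2 N hN.1 hN.2.1 (le_sup_left.trans hJN)
    exact ha (hNM ▸ hJN (Ideal.mem_sup_right (Ideal.mem_span_singleton_self a)))
  refine (isTIdeal_iff.1 hM.2.1 b).1 (MemT.of_forall_mul_mem hM0 hJ fun s hs => ?_)
  obtain ⟨m, hm, n, hn, rfl⟩ := Submodule.mem_sup.1 hs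
  obtain ⟨c, rfl⟩ := Ideal.mem_span_singleton'.1 hn
  rw [add_mul, mul_assoc]
  exact add_mem (M.mul_mem_right _ hm) (M.mul_mem_left _ hab)

theorem memT_of_forall_memLoc {A : Ideal D} (hA : A ≠ ⊥) {x : D}
    (h : ∀ M, IsTMax D M → MemLoc M A x) : MemT A x := by
  let J : Ideal D := Submodule.comap (LinearMap.mulRight D x) A
  have hJ : ∀ s, s ∈ J ↔ s * x ∈ A := fun s => Iff.rfl
  have hAJ : A ≤ J := fun a ha => A.mul_mem_right x ha
  refine MemT.of_forall_mul_mem (J := J) hA ?_ fun s hs => (hJ s).1 hs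
  by_contra hJ1
  obtain ⟨M, hM, hJM⟩ := exists_isTMax_ge (fun h => hA (le_bot_iff.1 (h ▸ hAJ))) hJ1
  obtain ⟨s, hs, hsx⟩ := h M hM
  exact hs (hJM ((hJ s).2 hsx))

theorem IsPvMD.exists_mem_mul_inv (hD : IsPvMD D) {M : Ideal D} (hM : IsTMax D M) {F : Ideal D}
    (hF : F.FG) (hF0 : F ≠ ⊥) :
    ∃ s ∉ M, algebraMap D (FractionRing D) s ∈ coeI D F * (1 / coeI D F) := by
  obtain ⟨G, hG⟩ := exists_coeI_eq (E := coeI D F * (1 / coeI D F)) Submodule.mul_one_div_le_one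
  have h := hD F hF0 hF
  by_contra! hs
  have hGM : G ≤ M := fun g hg => by
    by_contra hgM
    exact hs g hgM (hG ▸ algebraMap_mem_coeI.2 hg)
  refine hM.one_not_memT (MemT.mono hGM (algebraMap_mem_tSet_coeI.1 ?_))
  rw [hG, h]
  exact Submodule.mem_one.2 ⟨1, rfl⟩

theorem IsPvMD.memLoc_of_memT (hD : IsPvMD D) {M : Ideal D} (hM : IsTMax D M) {A : Ideal D}
    {x : D} (hx : MemT A x) : MemLoc M A x := by
  obtain ⟨F, hF, hF0, hFA, hFx⟩ := hx
  obtain ⟨s, hs, hsF⟩ := hD.exists_mem_mul_inv hM hF hF0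
  refine ⟨s, hs, hFA (algebraMap_mem_coeI.1 ?_)⟩
  rw [map_mul]
  generalize algebraMap D (FractionRing D) s = z at hsF
  induction hsF using Submodule.mul_induction_on' with
  | mem_mul_mem m hm n hn =>
    obtain ⟨d, hd⟩ := Submodule.mem_one.1 (hFx n fun f hf => hn _ (algebraMap_mem_coeI.2 hf))
    rw [mul_assoc, ← hd, mul_comm, ← Algebra.smul_def]
    exact Submodule.smul_mem _ _ hm
  | add a _ b _ ha hb =>
    rw [add_mul]
    exact add_mem ha hb

/-- In a PvMD, `D_M` is a valuation ring for every `t`-maximal ideal `M`. -/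
theorem IsPvMD.memLoc_span_or (hD : IsPvMD D) {M : Ideal D} (hM : IsTMax D M) (a b : D) :
    MemLoc M (Ideal.span {a}) b ∨ MemLoc M (Ideal.span {b}) a := by
  obtain rfl | ha := eq_or_ne a 0
  · exact Or.inr (memLoc_of_mem hM.1 (zero_mem _))
  have hF0 : Ideal.span {a, b} ≠ ⊥ := fun h => ha <| by
    simpa [h] using (Ideal.subset_span (by simp) : a ∈ Ideal.span {a, b})
  obtain ⟨s, hs, hsF⟩ := hD.exists_mem_mul_inv hM (Submodule.fg_span (Set.toFinite _)) hF0
  have key : ∀ z ∈ coeI D (Ideal.span {a, b}) * (1 / coeI D (Ideal.span {a, b})),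
      ∃ u v : D, z = algebraMap D _ (u + v) ∧ u * b ∈ Ideal.span {a} ∧ v * a ∈ Ideal.span {b} := by
    intro z hz
    induction hz using Submodule.mul_induction_on' with
    | mem_mul_mem m hm n hn =>
      obtain ⟨f, hf, rfl⟩ := mem_coeI.1 hm
      obtain ⟨p, q, rfl⟩ := Ideal.mem_span_pair.1 hf
      obtain ⟨c, hc⟩ := Submodule.mem_one.1
        (hn _ (algebraMap_mem_coeI.2 (Ideal.subset_span (by simp : a ∈ ({a, b} : Set D)))))
      obtain ⟨d, hd⟩ := Submodule.mem_one.1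
        (hn _ (algebraMap_mem_coeI.2 (Ideal.subset_span (by simp : b ∈ ({a, b} : Set D)))))
      have hcd : c * b = d * a := IsFractionRing.injective D (FractionRing D) (by
        rw [map_mul, map_mul, hc, hd]; ring)
      refine ⟨p * c, q * d, ?_, ?_, ?_⟩
      · simp only [map_add, map_mul, hc, hd]; ring
      · exact Ideal.mem_span_singleton'.2 ⟨p * d, by rw [mul_assoc, mul_assoc, hcd]⟩
      · exact Ideal.mem_span_singleton'.2 ⟨q * c, by rw [mul_assoc, mul_assoc, hcd]⟩
    | add x _ y _ hx hy =>
      obtain ⟨u, v, rfl, hu, hv⟩ := hx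
      obtain ⟨u', v', rfl, hu', hv'⟩ := hy
      refine ⟨u + u', v + v', by simp only [map_add]; ring, ?_, ?_⟩
      · rw [add_mul]; exact add_mem hu hu'
      · rw [add_mul]; exact add_mem hv hv'
  obtain ⟨u, v, huv, hu, hv⟩ := key _ hsF
  obtain rfl := IsFractionRing.injective D (FractionRing D) huv
  by_cases huM : u ∈ M
  · exact Or.inr ⟨v, fun hvM => hs (add_mem huM hvM), hv⟩
  · exact Or.inl ⟨u, huM, hu⟩

/-- If `I D_M` is idempotent and `x² ∈ I D_M`, then `x ∈ I D_M`. -/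
theorem IsPvMD.memLoc_of_mul_self (hD : IsPvMD D) {M : Ideal D} (hM : IsTMax D M) {I : Ideal D}
    (hI : ∀ a ∈ I, MemLoc M (I * I) a) {x : D} (hx : MemLoc M I (x * x)) : MemLoc M I x := by
  by_contra hxI
  have hx0 : x ≠ 0 := by
    rintro rfl
    exact hxI (memLoc_of_mem hM.1 (zero_mem I))
  have hIx : ∀ a ∈ I, MemLoc M (Ideal.span {x}) a := fun a ha =>
    (hD.memLoc_span_or hM x a).resolve_right fun h => hxI <| by
      obtain ⟨s, hs, hsx⟩ := h
      exact ⟨s, hs, (Ideal.span_singleton_le_iff_mem I).2 ha hsx⟩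
  have hxx : MemLoc M (Ideal.span {x} * I) (x * x) :=
    (hx.trans hM.isPrime hI).trans hM.isPrime
      (memLoc_mul hM.isPrime hIx fun a ha => memLoc_of_mem hM.1 ha)
  obtain ⟨s, hs, hsx⟩ := hxx
  obtain ⟨z, hz, hzx⟩ := Ideal.mem_span_singleton_mul.1 hsx
  refine hxI ⟨s, hs, ?_⟩
  rwa [← mul_left_cancel₀ hx0 (hzx.trans (mul_left_comm s x x))]

theorem IsPvMD.isPrime_locContraction (hD : IsPvMD D) {M : Ideal D} (hM : IsTMax D M) {I : Ideal D}
    (hI : ∀ a ∈ I, MemLoc M (I * I) a) (hIM : I ≤ M) :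
    (locContraction M hM.isPrime I).IsPrime := by
  refine ⟨fun h => ?_, fun {x y} hxy => ?_⟩
  · obtain ⟨s, hs, hs1⟩ := mem_locContraction.1 ((Ideal.eq_top_iff_one _).1 h)
    exact hs (hIM (by rwa [mul_one] at hs1))
  have key : ∀ {x y : D}, MemLoc M I (x * y) → MemLoc M (Ideal.span {y}) x → MemLoc M I x := by
    rintro x y hxy ⟨s, hs, hsx⟩
    obtain ⟨c, hc⟩ := Ideal.mem_span_singleton'.1 hsx
    refine hD.memLoc_of_mul_self hM hI (MemLoc.trans (A := locContraction M hM.isPrime I)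
      ⟨s, hs, ?_⟩ hM.isPrime fun a ha => ha)
    rw [← mul_assoc, ← hc, mul_assoc, mul_comm y]
    exact Ideal.mul_mem_left _ _ hxy
  rcases hD.memLoc_span_or hM x y with h | h
  · exact Or.inr (key (mul_comm x y ▸ hxy) h)
  · exact Or.inl (key hxy h)

theorem TIdem.memLoc_mul_self {A : Ideal D} (hA : TIdem D A) (hD : IsPvMD D) {M : Ideal D}
    (hM : IsTMax D M) : ∀ a ∈ A, MemLoc M (A * A) a := by
  intro a ha
  obtain rfl | ha0 := eq_or_ne a 0
  · exact memLoc_of_mem hM.1 (zero_mem _)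
  · exact hD.memLoc_of_memT hM (tIdem_iff.1 hA a (memT_of_mem_of_ne_zero ha ha0))

theorem tIdem_of_forall_memLoc {A : Ideal D} (hA : IsTIdeal D A)
    (h : ∀ M, IsTMax D M → ∀ a ∈ A, MemLoc M (A * A) a) : TIdem D A := by
  refine tIdem_iff.2 fun x hx => memT_of_forall_memLoc (mul_ne_zero hA.ne_bot hA.ne_bot) ?_
  exact fun M hM => h M hM x ((isTIdeal_iff.1 hA x).1 hx)

theorem memLoc_prod_mul_self (hD : IsPvMD D) {M : Ideal D} (hM : IsTMax D M)
    (s : Multiset (Ideal D)) (hs : ∀ P ∈ s, TIdem D P) :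
    ∀ a ∈ s.prod, MemLoc M (s.prod * s.prod) a := by
  induction s using Multiset.induction_on with
  | empty =>
    intro a _
    rw [Multiset.prod_zero, one_mul]
    exact memLoc_of_mem hM.1 (by simp)
  | cons P s ih =>
    rw [Multiset.prod_cons, mul_mul_mul_comm]
    exact memLoc_mul hM.isPrime ((hs P (by simp)).memLoc_mul_self hD hM)
      (ih fun Q hQ => hs Q (Multiset.mem_cons_of_mem hQ))

/-- If a `t`-ideal is the `t`-closure of a product of `t`-idempotent ideals, it is
`t`-idempotent. -/
theorem tIdem_of_memT_prod_iff (hD : IsPvMD D) {I : Ideal D} (hI : IsTIdeal D I)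
    (s : Multiset (Ideal D)) (hs : ∀ P ∈ s, TIdem D P) (h : ∀ x, MemT s.prod x ↔ x ∈ I) :
    TIdem D I := by
  have hle : s.prod ≤ I := by
    intro x hx
    obtain rfl | hx0 := eq_or_ne x 0
    · exact zero_mem I
    · exact (h x).1 (memT_of_mem_of_ne_zero hx hx0)
  refine tIdem_of_forall_memLoc hI fun M hM a ha => ?_
  obtain ⟨u, hu, hua⟩ := (hD.memLoc_of_memT hM ((h a).2 ha)).trans hM.isPrime
    (memLoc_prod_mul_self hD hM s hs)
  exact ⟨u, hu, Ideal.mul_mono hle hle hua⟩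

/-- A `t`-idempotent `t`-ideal is the `t`-closure of the product of its localizations at the
`t`-maximal ideals containing it. -/
theorem TIdem.exists_multiset_prod {I : Ideal D} (hidem : TIdem D I) (hD : IsPvMD D)
    (hfc : FiniteTCharacter D) (hI : IsTIdeal D I) :
    ∃ s : Multiset (Ideal D), (∀ P ∈ s, P.IsPrime ∧ IsTIdeal D P ∧ TIdem D P) ∧
      ∀ x, MemT s.prod x ↔ x ∈ I := by
  classical
  have hI0 := hI.ne_bot
  obtain ⟨a, haI, ha0⟩ := Submodule.exists_mem_ne_zero_of_ne_bot hI0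
  have hloc : ∀ M, IsTMax D M → ∀ a ∈ I, MemLoc M (I * I) a := fun M hM =>
    hidem.memLoc_mul_self hD hM
  let S : Set (Ideal D) := {P | ∃ M, ∃ hM : IsTMax D M, I ≤ M ∧ locContraction M hM.isPrime I = P}
  have hS : S.Finite := by
    refine ((hfc a ha0).dependent_image fun M hM => locContraction M hM.1.isPrime I).subset ?_
    rintro _ ⟨M, hM, hIM, rfl⟩
    exact ⟨M, ⟨hM, hIM haI⟩, rfl⟩
  have hprime : ∀ P ∈ S, P.IsPrime := by
    rintro _ ⟨M, hM, hIM, rfl⟩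
    exact hD.isPrime_locContraction hM (hloc M hM) hIM
  have hIP : ∀ P ∈ S, I ≤ P := by
    rintro _ ⟨M, hM, -, rfl⟩
    exact le_locContraction M hM.isPrime I
  have huniq : ∀ P ∈ S, ∀ M, ∀ hM : IsTMax D M, P ≤ M → P = locContraction M hM.isPrime I := by
    rintro P hP M hM hPM
    have hle := locContraction_le_of_le hM.isPrime (hprime P hP) (hIP P hP) hPM
    refine le_antisymm ?_ hle
    have hIM := (hIP P hP).trans hPM
    obtain ⟨N, hN, hIN, rfl⟩ := hP
    exact locContraction_le_of_le hN.isPrime (hD.isPrime_locContraction hM (hloc M hM) hIM)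
      (le_locContraction M hM.isPrime I)
      (hle.trans (locContraction_le_of_le hN.isPrime hN.isPrime hIN le_rfl))
  have htideal : ∀ P ∈ S, IsTIdeal D P := by
    rintro _ ⟨M, hM, hIM, rfl⟩
    refine isTIdeal_iff.2 fun x => ⟨fun hx => ?_, memT_of_mem fun h => hI0 (le_bot_iff.1 ?_)⟩
    · exact (hD.memLoc_of_memT hM hx).trans hM.isPrime fun a ha => ha
    · exact h ▸ le_locContraction M hM.isPrime I
  refine ⟨hS.toFinset.val, fun P hP => ?_, fun x => ⟨fun hx => ?_, fun hx => ?_⟩⟩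
  · replace hP : P ∈ S := by simpa using hP
    refine ⟨hprime P hP, htideal P hP, tIdem_of_forall_memLoc (htideal P hP) fun M hM x hx => ?_⟩
    by_cases hPM : P ≤ M
    · have hx' : MemLoc M I x := by
        rwa [huniq P hP M hM hPM] at hx
      obtain ⟨u, hu, hux⟩ := hx'.trans hM.isPrime (hloc M hM)
      exact ⟨u, hu, Ideal.mul_mono (hIP P hP) (hIP P hP) hux⟩
    · obtain ⟨u, huP, hu⟩ := SetLike.not_le_iff_exists.1 hPM
      exact ⟨u, hu, Ideal.mul_mem_mul huP hx⟩
  · refine (isTIdeal_iff.1 hI x).1 (memT_of_forall_memLoc hI0 fun M hM => ?_)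
    by_cases hIM : I ≤ M
    · have hmem : locContraction M hM.isPrime I ∈ S := ⟨M, hM, hIM, rfl⟩
      have hle : hS.toFinset.val.prod ≤ locContraction M hM.isPrime I :=
        Ideal.multiset_prod_le_inf.trans (Multiset.inf_le (by simpa using hmem))
      exact (isTIdeal_iff.1 (htideal _ hmem) x).1 (hx.mono hle)
    · obtain ⟨u, huI, hu⟩ := SetLike.not_le_iff_exists.1 hIM
      exact ⟨u, hu, I.mul_mem_right x huI⟩
  · have hprod : hS.toFinset.val.prod = ∏ P ∈ hS.toFinset, P := Finset.prod_val _
    refine memT_of_forall_memLoc ?_ fun M hM => ?_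
    · rw [hprod, ← Ideal.zero_eq_bot, Finset.prod_ne_zero_iff]
      exact fun P hP => (htideal P (by simpa using hP)).ne_bot
    rw [hprod]
    set Q := locContraction M hM.isPrime I
    have hex : ∀ P ∈ hS.toFinset.erase Q, ∃ u ∈ P, u ∉ M := by
      intro P hP
      rw [Finset.mem_erase, Set.Finite.mem_toFinset] at hP
      exact SetLike.not_le_iff_exists.1 fun h => hP.1 (huniq P hP.2 M hM h)
    choose! u huP huM using hex
    have hu : ∏ P ∈ hS.toFinset.erase Q, u P ∉ M := fun h => by
      obtain ⟨P, hP, h⟩ := (hM.isPrime.prod_mem_iff).1 h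
      exact huM P hP h
    refine ⟨_, hu, ?_⟩
    by_cases hQ : Q ∈ hS.toFinset
    · rw [← Finset.prod_erase_mul _ _ hQ]
      exact Ideal.mul_mem_mul (Ideal.prod_mem_prod huP) (le_locContraction M hM.isPrime I hx)
    · have := Ideal.prod_mem_prod huP
      rw [Finset.erase_eq_of_notMem hQ] at this ⊢
      exact Ideal.mul_mem_right _ _ this

end TClosure

theorem statement17 (D : Type*) [CommRing D] [IsDomain D]
    (hPvMD : IsPvMD D) (hfc : FiniteTCharacter D)
    (I : Ideal D) (hI0 : I ≠ ⊥) (hItop : I ≠ ⊤) (hIt : IsTIdeal D I) :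
    TIdem D I ↔
      ∃ s : Multiset (Ideal D),
        (∀ P ∈ s, P.IsPrime ∧ IsTIdeal D P ∧ TIdem D P) ∧
        tSet D (coeI D s.prod) = (coeI D I : Set (FractionRing D)) := by
  constructor
  · intro h
    obtain ⟨s, hs, hprod⟩ := h.exists_multiset_prod hPvMD hfc hIt
    exact ⟨s, hs, tSet_coeI_eq_coeI_iff.2 hprod⟩
  · rintro ⟨s, hs, hprod⟩
    exact tIdem_of_memT_prod_iff hPvMD hIt s (fun P hP => (hs P hP).2.2)
      (tSet_coeI_eq_coeI_iff.1 hprod)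

end
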